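/- arXiv:2106.11704 — 2 statements merged into one kernel-verified Lean document; each statement's English description precedes it below -/
import Mathlib

section
/- Let N ≥ 1 be an integer, and for integers r, s define e_{r,s} := exp(−πi·r·s/N)·P^r·Q^s with P the shift matrix and Q the clock matrix. Then for all integers j, k, r, s the commutator satisfies the sine-algebra relation [e_{j,k}, e_{r,s}] = e_{j,k}·e_{r,s} − e_{r,s}·e_{j,k} = 2i·sin(π(j·s − k·r)/N)·e_{j+r, k+s}. -/
open Matrix Complex

/-- The clock matrix `Q` with `Q j j = ω ^ j`, `ω = exp (2πi/N)`. -/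
noncomputable def clock (N : ℕ) : Matrix (Fin N) (Fin N) ℂ :=
  Matrix.diagonal fun j => Complex.exp (2 * Real.pi * Complex.I / N) ^ (j : ℕ)

/-- The cyclic shift matrix `P` with `P j k = 1` iff `k ≡ j + 1 (mod N)`. -/
def shift (N : ℕ) : Matrix (Fin N) (Fin N) ℂ :=
  Matrix.of fun j k => if (k : ℕ) = ((j : ℕ) + 1) % N then 1 else 0

/-- `e_{r,s} = exp(-πi r s / N) • P^r Q^s` for integers `r`, `s` (integer powers of the
invertible matrices `P` and `Q`). -/
noncomputable def eMat (N : ℕ) (r s : ℤ) : Matrix (Fin N) (Fin N) ℂ :=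
  Complex.exp (-(Real.pi * Complex.I * r * s) / N) • (shift N ^ r * clock N ^ s)

theorem Matrix.smul_zpow_of_ne_zero {n K : Type*} [Fintype n] [DecidableEq n] [Field K]
    {c : K} (hc : c ≠ 0) {A : Matrix n n K} (hA : IsUnit A.det) (m : ℤ) :
    (c • A) ^ m = c ^ m • A ^ m := by
  cases m with
  | ofNat m => simp [smul_pow]
  | negSucc m =>
    rw [zpow_negSucc, zpow_negSucc, zpow_negSucc, smul_pow]
    have hdet : IsUnit (A ^ (m + 1)).det := by
      rw [Matrix.det_pow]
      exact hA.pow _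
    exact Matrix.inv_smul' (A ^ (m + 1)) (Units.mk0 _ (pow_ne_zero (m + 1) hc)) hdet

theorem Matrix.isUnit_det_smul_of_ne_zero {n K : Type*} [Fintype n] [DecidableEq n] [Field K]
    {c : K} (hc : c ≠ 0) {A : Matrix n n K} (hA : IsUnit A.det) : IsUnit (c • A).det := by
  rw [Matrix.det_smul]
  exact (hc.isUnit.pow _).mul hA

/-- If `A B = c B A` with `c ≠ 0` and `A`, `B` invertible, then
`A ^ r B ^ k = c ^ (k r) B ^ k A ^ r` for all integers `r`, `k`. -/
theorem Matrix.zpow_mul_zpow_of_mul_eq_smul {n K : Type*} [Fintype n] [DecidableEq n] [Field K]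
    {c : K} (hc : c ≠ 0) {A B : Matrix n n K} (hA : IsUnit A.det) (hB : IsUnit B.det)
    (h : A * B = c • (B * A)) (r k : ℤ) :
    A ^ r * B ^ k = c ^ (k * r) • (B ^ k * A ^ r) := by
  have hAB : A * B ^ k = c ^ k • (B ^ k * A) := by
    have hsemi : SemiconjBy A B (c • B) := by simpa [SemiconjBy] using h
    have := (Matrix.SemiconjBy.zpow_right hB (Matrix.isUnit_det_smul_of_ne_zero hc hB) hsemi k).eq
    rwa [Matrix.smul_zpow_of_ne_zero hc hB, smul_mul_assoc] at this
  have hck : c ^ k ≠ 0 := zpow_ne_zero k hc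
  have hsemi : SemiconjBy (B ^ k) (c ^ k • A) A := by
    simp [SemiconjBy, hAB]
  have := (Matrix.SemiconjBy.zpow_right (Matrix.isUnit_det_smul_of_ne_zero hck hA) hA hsemi r).eq
  rw [Matrix.smul_zpow_of_ne_zero hck hA, mul_smul_comm, ← _root_.zpow_mul] at this
  exact this.symm

theorem isUnit_det_clock (N : ℕ) : IsUnit (clock N).det := by
  rw [clock, Matrix.det_diagonal, isUnit_iff_ne_zero, Finset.prod_ne_zero_iff]
  exact fun j _ => pow_ne_zero _ (Complex.exp_ne_zero _)

theorem shift_mul_transpose (N : ℕ) : shift N * (shift N)ᵀ = 1 := by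
  ext a b
  have hN : 0 < N := a.pos
  rw [Matrix.mul_apply, Finset.sum_eq_single ⟨((a : ℕ) + 1) % N, Nat.mod_lt _ hN⟩]
  · have key : ((a : ℕ) + 1) % N = ((b : ℕ) + 1) % N ↔ a = b := by
      refine ⟨fun h => ?_, fun h => h ▸ rfl⟩
      have h' : (a : ℕ) ≡ b [MOD N] := Nat.ModEq.add_right_cancel' 1 h
      exact Fin.ext (Nat.ModEq.eq_of_lt_of_lt h' a.isLt b.isLt)
    simp [shift, Matrix.one_apply, key]
  · intro c _ hc
    have hne : (c : ℕ) ≠ ((a : ℕ) + 1) % N := fun h => hc (Fin.ext h)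
    simp [shift, hne]
  · simp

theorem isUnit_det_shift (N : ℕ) : IsUnit (shift N).det :=
  Matrix.isUnit_det_of_right_inverse (shift_mul_transpose N)

theorem shift_mul_clock (N : ℕ) :
    shift N * clock N = Complex.exp (2 * Real.pi * Complex.I / N) • (clock N * shift N) := by
  ext a b
  have hN : (N : ℂ) ≠ 0 := Nat.cast_ne_zero.mpr a.pos.ne'
  have hpow : Complex.exp (2 * Real.pi * Complex.I / N) ^ N = 1 := by
    rw [← Complex.exp_nat_mul, mul_div_cancel₀ _ hN, Complex.exp_two_pi_mul_I]
  rw [clock, Matrix.mul_diagonal, Matrix.smul_apply, Matrix.diagonal_mul]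
  by_cases h : (b : ℕ) = ((a : ℕ) + 1) % N
  · simp only [shift, Matrix.of_apply, if_pos h, one_mul, mul_one, smul_eq_mul]
    rw [h, ← pow_eq_pow_mod _ hpow, pow_succ']
  · simp [shift, h]

theorem clock_zpow_mul_shift_zpow (N : ℕ) (k r : ℤ) :
    clock N ^ k * shift N ^ r =
      Complex.exp (-(2 * Real.pi * Complex.I * k * r) / N) • (shift N ^ r * clock N ^ k) := by
  rw [Matrix.zpow_mul_zpow_of_mul_eq_smul (Complex.exp_ne_zero _) (isUnit_det_shift N)
    (isUnit_det_clock N) (shift_mul_clock N), smul_smul, ← Complex.exp_int_mul,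
    ← Complex.exp_add]
  have : -(2 * Real.pi * Complex.I * k * r) / N +
      ((k * r : ℤ) : ℂ) * (2 * Real.pi * Complex.I / N) = 0 := by
    push_cast
    ring
  rw [this, Complex.exp_zero, one_smul]

theorem eMat_mul (N : ℕ) (j k r s : ℤ) :
    eMat N j k * eMat N r s =
      Complex.exp (Real.pi * ((j * s - k * r : ℤ) : ℂ) / N * Complex.I) •
        eMat N (j + r) (k + s) := by
  have hmul : shift N ^ j * clock N ^ k * (shift N ^ r * clock N ^ s) =
      Complex.exp (-(2 * Real.pi * Complex.I * k * r) / N) •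
        (shift N ^ (j + r) * clock N ^ (k + s)) := by
    rw [Matrix.zpow_add (isUnit_det_shift N), Matrix.zpow_add (isUnit_det_clock N),
      mul_assoc, ← mul_assoc (clock N ^ k), clock_zpow_mul_shift_zpow]
    simp only [smul_mul_assoc, mul_smul_comm, mul_assoc]
  simp only [eMat]
  rw [smul_mul_smul_comm, hmul, smul_smul, smul_smul, ← Complex.exp_add, ← Complex.exp_add,
    ← Complex.exp_add]
  congr 2
  push_cast
  ring

/-- The sine-algebra commutation relation
`[e_{j,k}, e_{r,s}] = 2i sin(π (j s - k r)/N) e_{j+r,k+s}`. -/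
theorem eMat_commutator (N : ℕ) (hN : 1 ≤ N) (j k r s : ℤ) :
    eMat N j k * eMat N r s - eMat N r s * eMat N j k =
      (2 * Complex.I * Complex.sin (Real.pi * ((j * s - k * r : ℤ) : ℂ) / N)) •
        eMat N (j + r) (k + s) := by
  have hneg : Real.pi * ((r * k - s * j : ℤ) : ℂ) / N * Complex.I =
      -(Real.pi * ((j * s - k * r : ℤ) : ℂ) / N) * Complex.I := by
    push_cast
    ring
  rw [eMat_mul, eMat_mul, add_comm r j, add_comm s k, ← sub_smul, hneg, Complex.sin]
  congr 1
  linear_combination (Complex.exp (Real.pi * ((j * s - k * r : ℤ) : ℂ) / N * Complex.I) -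
    Complex.exp (-(Real.pi * ((j * s - k * r : ℤ) : ℂ) / N) * Complex.I)) * Complex.I_sq
end

section
/- On the space of finitely supported functions ℤ² → ℂ define the Poisson bracket in Fourier coefficients by ({φ,ψ})(p) := − Σ_{k+m=p} (k₁m₂ − k₂m₁)·φ(k)·ψ(m) (a finite sum over pairs k, m ∈ ℤ² with k + m = p). Let B be the set of ψ with ψ(m) = 0 whenever m₁ < 0 and conj(ψ(0,k)) = −ψ(0,−k) for all k ∈ ℤ. Then B is closed under the bracket: if φ, ψ ∈ B then {φ,ψ} ∈ B. -/
open Complex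

/-- The Poisson bracket in Fourier coefficients:
`{φ,ψ}(p) = -Σ_{k+m=p} (k₁ m₂ - k₂ m₁) φ(k) ψ(m)` (a finite sum, written as a sum over
the support of `φ` with `m = p - k`). -/
noncomputable def fourierBracket (φ ψ : (ℤ × ℤ) →₀ ℂ) (p : ℤ × ℤ) : ℂ :=
  -(φ.sum fun k a => ((k.1 * (p - k).2 - k.2 * (p - k).1 : ℤ) : ℂ) * a * ψ (p - k))

/-- Membership in `B` for a function `ℤ² → ℂ`: it vanishes for `m₁ < 0`, and the `m₁ = 0`
modes satisfy `conj ψ(0,k) = -ψ(0,-k)`. -/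
def memB (ψ : ℤ × ℤ → ℂ) : Prop :=
  (∀ m : ℤ × ℤ, m.1 < 0 → ψ m = 0) ∧
  (∀ k : ℤ, (starRingEnd ℂ) (ψ (0, k)) = -ψ (0, -k))

theorem fourierBracket_eq_zero_of_fst_nonpos {φ ψ : (ℤ × ℤ) →₀ ℂ}
    (hφ : ∀ m : ℤ × ℤ, m.1 < 0 → φ m = 0) (hψ : ∀ m : ℤ × ℤ, m.1 < 0 → ψ m = 0)
    {p : ℤ × ℤ} (hp : p.1 ≤ 0) : fourierBracket φ ψ p = 0 := by
  rw [fourierBracket, neg_eq_zero]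
  refine Finset.sum_eq_zero fun k _ => ?_
  rcases lt_trichotomy k.1 0 with hk | hk | hk
  · simp [hφ k hk]
  · rcases hp.lt_or_eq with h | h
    · simp [hψ (p - k) (by simpa [hk] using h)]
    · simp [hk, h]
  · simp [hψ (p - k) (by rw [Prod.fst_sub]; lia)]

/-- The subalgebra `B` is closed under the Poisson bracket. -/
theorem B_closed_under_bracket (φ ψ : (ℤ × ℤ) →₀ ℂ)
    (hφ : memB ⇑φ) (hψ : memB ⇑ψ) :
    memB (fourierBracket φ ψ) := by
  refine ⟨fun m hm => fourierBracket_eq_zero_of_fst_nonpos hφ.1 hψ.1 hm.le, fun k => ?_⟩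
  simp [fourierBracket_eq_zero_of_fst_nonpos hφ.1 hψ.1 (p := (0, _)) le_rfl]
end
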